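/- Let β ∈ ℝ \ {0} and k ∈ ℝ. Then the function Ψ_δ'(t,x;k) satisfies: (a) i·∂Ψ_δ'/∂t(t,x;k) = −∂²Ψ_δ'/∂x²(t,x;k) for all t > 0 and x ∈ ℝ \ {0}; (b) for every t > 0 the one-sided limits lim_{x→0⁺} ∂Ψ_δ'/∂x(t,x;k) and lim_{x→0⁻} ∂Ψ_δ'/∂x(t,x;k) exist and are equal (call their common value ∂_xΨ_δ'(t,0;k)); (c) for every t > 0, lim_{x→0⁺} Ψ_δ'(t,x;k) − lim_{x→0⁻} Ψ_δ'(t,x;k) = (2/β)·∂_xΨ_δ'(t,0;k); (d) for every x ∈ ℝ \ {0}, lim_{t→0⁺} Ψ_δ'(t,x;k) = exp(i·k·x). -/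

import Mathlib

/-- The modified error function `Λ(z) = exp(z²)·(1 − (2/√π)·∫₀^z exp(−ξ²) dξ)`,
where the integral is the complex line integral along the segment from `0` to `z`. -/
noncomputable def Lam (z : ℂ) : ℂ :=
  Complex.exp (z ^ 2) *
    (1 - (2 / (Real.sqrt Real.pi : ℂ)) * ∫ s in (0:ℝ)..1, z * Complex.exp (-((s : ℂ) * z) ^ 2))

/-- For `t > 0`, the principal square root of `i·t`, namely `√t·(1+i)/√2`. -/
noncomputable def sqrtit (t : ℝ) : ℂ :=
  (Real.sqrt t : ℂ) * (1 + Complex.I) / (Real.sqrt 2 : ℂ)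

/-- The free plane-wave solution `Ψ_free(t,x;k) = exp(i·k·x − i·k²·t)`. -/
noncomputable def psiFree (k t x : ℝ) : ℂ :=
  Complex.exp (Complex.I * k * x - Complex.I * k ^ 2 * t)

/-- `φ_δ(t,x;k)` from the explicit solution for the δ-potential of strength `2α`. -/
noncomputable def phiDelta (α k t x : ℝ) : ℂ :=
  ((α : ℂ) / (2 * ((α : ℂ) + Complex.I * k))) *
    Complex.exp (-(x : ℂ) ^ 2 / (4 * Complex.I * t)) *
    (Lam (((|x| : ℝ) : ℂ) / (2 * sqrtit t) + (α : ℂ) * sqrtit t)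
      - Lam (((|x| : ℝ) : ℂ) / (2 * sqrtit t) - Complex.I * k * sqrtit t))

/-- `Ψ_δ(t,x;k) = Ψ_free(t,x;k) + φ_δ(t,x;k) + φ_δ(t,−x;−k)`. -/
noncomputable def psiDelta (α k t x : ℝ) : ℂ :=
  psiFree k t x + phiDelta α k t x + phiDelta α (-k) t (-x)

/-- `φ_δ'(t,x;k)` from the explicit solution for the δ'-potential of strength `2/β`. -/
noncomputable def phiDelta' (β k t x : ℝ) : ℂ :=
  ((Real.sign x : ℂ) / (2 * ((β : ℂ) + Complex.I * k))) *
    Complex.exp (-(x : ℂ) ^ 2 / (4 * Complex.I * t)) *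
    ((β : ℂ) * Lam (((|x| : ℝ) : ℂ) / (2 * sqrtit t) + (β : ℂ) * sqrtit t)
      + Complex.I * k * Lam (((|x| : ℝ) : ℂ) / (2 * sqrtit t) - Complex.I * k * sqrtit t))

/-- `Ψ_δ'(t,x;k) = Ψ_free(t,x;k) + φ_δ'(t,x;k) + φ_δ'(t,−x;−k)`. -/
noncomputable def psiDelta' (β k t x : ℝ) : ℂ :=
  psiFree k t x + phiDelta' β k t x + phiDelta' β (-k) t (-x)

open Filter Topology

open MeasureTheory

lemma hasDerivAt_segmentIntegral_exp_neg_sq (z : ℂ) :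
    HasDerivAt (fun w : ℂ => ∫ s in (0:ℝ)..1, w * Complex.exp (-((s : ℂ) * w) ^ 2))
      (Complex.exp (-z ^ 2)) z := by
  obtain ⟨P, hP⟩ := (show Differentiable ℂ fun w : ℂ => Complex.exp (-w ^ 2) by
    fun_prop).isExactOn_univ
  have hint : ∀ w : ℂ, ∫ s in (0:ℝ)..1, w * Complex.exp (-((s : ℂ) * w) ^ 2) = P w - P 0 := by
    intro w
    have h : ∀ s ∈ Set.uIcc (0:ℝ) 1, HasDerivAt (fun s : ℝ => P ((s : ℂ) * w))
        (w * Complex.exp (-((s : ℂ) * w) ^ 2)) s := by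
      intro s _
      have h1 : HasDerivAt (fun s : ℝ => (s : ℂ) * w) (1 * w) s :=
        (Complex.ofRealCLM.hasDerivAt (x := s)).mul_const w
      have h2 := (hP ((s : ℂ) * w) (Set.mem_univ _)).comp s h1
      exact h2.congr_deriv (by ring)
    rw [intervalIntegral.integral_eq_sub_of_hasDerivAt h
      (Continuous.intervalIntegrable (by fun_prop) _ _)]
    simp
  simp only [hint]
  exact (hP z (Set.mem_univ z)).sub_const _

lemma hasDerivAt_Lam (z : ℂ) :
    HasDerivAt Lam (2 * z * Lam z - 2 / (Real.sqrt Real.pi : ℂ)) z := by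
  have h1 : HasDerivAt (fun w : ℂ => Complex.exp (w ^ 2)) (Complex.exp (z ^ 2) * (2 * z)) z := by
    simpa using (hasDerivAt_pow 2 z).cexp
  have h2 := ((hasDerivAt_segmentIntegral_exp_neg_sq z).const_mul
    (2 / (Real.sqrt Real.pi : ℂ))).const_sub 1
  refine (h1.mul h2).congr_deriv ?_
  have : Complex.exp (z ^ 2) * Complex.exp (-z ^ 2) = 1 := by
    rw [← Complex.exp_add]; simp
  simp only [Lam]
  linear_combination (-2 / (Real.sqrt Real.pi : ℂ)) * this

lemma continuous_Lam : Continuous Lam :=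
  continuous_iff_continuousAt.2 fun z => (hasDerivAt_Lam z).continuousAt

@[simp] lemma Lam_zero : Lam 0 = 1 := by simp [Lam]

lemma Lam_add_Lam_neg (z : ℂ) : Lam z + Lam (-z) = 2 * Complex.exp (z ^ 2) := by
  have : ∫ s in (0:ℝ)..1, -z * Complex.exp (-((s : ℂ) * -z) ^ 2) =
      -∫ s in (0:ℝ)..1, z * Complex.exp (-((s : ℂ) * z) ^ 2) := by
    rw [← intervalIntegral.integral_neg]
    simp
  simp only [Lam, this, neg_sq]
  ring

lemma norm_cexp_neg_sq_sub (z : ℂ) (u : ℝ) :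
    ‖Complex.exp (-(u : ℂ) ^ 2 - 2 * z * u)‖ = Real.exp (-u ^ 2 - 2 * z.re * u) := by
  rw [Complex.norm_exp]
  congr 1
  simp [pow_two]

lemma integrable_cexp_neg_sq_sub (z : ℂ) :
    Integrable fun u : ℝ => Complex.exp (-(u : ℂ) ^ 2 - 2 * z * u) := by
  have h := integrable_cexp_quadratic (b := 1) (by simp) (-(2 * z)) 0
  refine h.congr (.of_forall fun u => ?_)
  simp only
  congr 1
  ring

lemma hasDerivAt_integral_Ioi_cexp_neg_sq_sub (z : ℂ) :
    HasDerivAt (fun w : ℂ => ∫ u in Set.Ioi (0:ℝ), Complex.exp (-(u : ℂ) ^ 2 - 2 * w * u))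
      (2 * z * (∫ u in Set.Ioi (0:ℝ), Complex.exp (-(u : ℂ) ^ 2 - 2 * z * u)) - 1) z := by
  have hderiv : ∀ (u : ℝ) (w : ℂ), HasDerivAt
      (fun w : ℂ => Complex.exp (-(u : ℂ) ^ 2 - 2 * w * u))
      (-2 * u * Complex.exp (-(u : ℂ) ^ 2 - 2 * w * u)) w := by
    intro u w
    have h := ((((hasDerivAt_id w).const_mul 2).mul_const (u : ℂ)).const_sub
      (-(u : ℂ) ^ 2)).cexp
    refine h.congr_deriv ?_
    simp only [id]
    ring
  have hmain := hasDerivAt_integral_of_dominated_loc_of_deriv_le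
    (μ := volume.restrict (Set.Ioi (0:ℝ))) (x₀ := z) (s := Metric.ball z 1)
    (F := fun w u => Complex.exp (-(u : ℂ) ^ 2 - 2 * w * u))
    (F' := fun w u => -2 * u * Complex.exp (-(u : ℂ) ^ 2 - 2 * w * u))
    (bound := fun u => 2 * ‖Complex.exp (-(u : ℂ) ^ 2 - 2 * (-(‖z‖ + 3 / 2 : ℝ) : ℂ) * u)‖)
    (Metric.ball_mem_nhds z one_pos)
    (.of_forall fun w => (integrable_cexp_neg_sq_sub w).aestronglyMeasurable.restrict)
    (integrable_cexp_neg_sq_sub z).restrict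
    (Continuous.aestronglyMeasurable (by fun_prop))
    (by
      filter_upwards [ae_restrict_mem measurableSet_Ioi] with u hu w hw
      have hu' : 0 < u := hu
      have hwz : -w.re ≤ ‖z‖ + 1 := by
        have h1 : ‖w - z‖ < 1 := by simpa [dist_eq_norm] using hw
        have h2 : ‖w‖ ≤ ‖w - z‖ + ‖z‖ := by simpa using norm_add_le (w - z) z
        have h3 := (abs_le.1 (Complex.abs_re_le_norm w)).1
        linarith
      rw [norm_mul, norm_cexp_neg_sq_sub, norm_cexp_neg_sq_sub, norm_mul, norm_neg,
        Complex.norm_real, Real.norm_of_nonneg hu'.le, Complex.norm_ofNat, mul_assoc]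
      refine mul_le_mul_of_nonneg_left ?_ zero_le_two
      have hexp : u ≤ Real.exp u := by linarith [Real.add_one_le_exp u]
      refine (mul_le_mul_of_nonneg_right hexp (Real.exp_pos _).le).trans ?_
      rw [← Real.exp_add]
      refine Real.exp_le_exp.2 ?_
      simp only [Complex.neg_re, Complex.ofReal_re]
      nlinarith)
    ((integrable_cexp_neg_sq_sub _).norm.const_mul 2).restrict
    (.of_forall fun u w _ => hderiv u w)
  refine hmain.2.congr_deriv ?_
  have hlim : Tendsto (fun u : ℝ => Complex.exp (-(u : ℂ) ^ 2 - 2 * z * u)) atTop (𝓝 0) := by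
    rw [tendsto_zero_iff_norm_tendsto_zero]
    simp only [norm_cexp_neg_sq_sub]
    refine Real.tendsto_exp_atBot.comp ?_
    have h : Tendsto (fun u : ℝ => u * (-u - 2 * z.re)) atTop atBot :=
      tendsto_id.atTop_mul_atBot₀
        (tendsto_atBot_add_const_right _ _ tendsto_neg_atTop_atBot)
    refine h.congr fun u => ?_
    ring
  have hftc := integral_Ioi_of_hasDerivAt_of_tendsto' (a := 0)
    (f := fun u : ℝ => Complex.exp (-(u : ℂ) ^ 2 - 2 * z * u))
    (f' := fun u : ℝ => -2 * u * Complex.exp (-(u : ℂ) ^ 2 - 2 * z * u) -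
      2 * z * Complex.exp (-(u : ℂ) ^ 2 - 2 * z * u)) (fun u _ => by
      have h0 : HasDerivAt (fun u : ℂ => Complex.exp (-u ^ 2 - 2 * z * u))
          (Complex.exp (-(u : ℂ) ^ 2 - 2 * z * u) * (-(2 * u) - 2 * z)) (u : ℂ) := by
        have := ((hasDerivAt_pow 2 (u : ℂ)).neg.sub
          ((hasDerivAt_id (u : ℂ)).const_mul (2 * z))).cexp
        simpa using this
      refine h0.comp_ofReal.congr_deriv ?_
      ring)
    (hmain.1.sub ((integrable_cexp_neg_sq_sub z).restrict.const_mul _)) hlim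
  rw [integral_sub hmain.1 ((integrable_cexp_neg_sq_sub z).restrict.const_mul _),
    integral_const_mul] at hftc
  simp only [Complex.ofReal_zero, ne_eq, OfNat.ofNat_ne_zero, not_false_eq_true, zero_pow,
    mul_zero, neg_zero, sub_zero, Complex.exp_zero] at hftc
  linear_combination hftc

lemma Lam_eq_integral (z : ℂ) :
    Lam z = 2 / (Real.sqrt Real.pi : ℂ) *
      ∫ u in Set.Ioi (0:ℝ), Complex.exp (-(u : ℂ) ^ 2 - 2 * z * u) := by
  set K : ℂ → ℂ := fun w => ∫ u in Set.Ioi (0:ℝ), Complex.exp (-(u : ℂ) ^ 2 - 2 * w * u)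
    with hK
  have hd : ∀ w, HasDerivAt (fun w : ℂ => Complex.exp (-w ^ 2) *
      (Lam w - 2 / (Real.sqrt Real.pi : ℂ) * K w)) 0 w := by
    intro w
    have h1 : HasDerivAt (fun w : ℂ => Complex.exp (-w ^ 2))
        (Complex.exp (-w ^ 2) * (-(2 * w))) w := by
      simpa using (hasDerivAt_pow 2 w).neg.cexp
    refine (h1.mul ((hasDerivAt_Lam w).sub
      ((hasDerivAt_integral_Ioi_cexp_neg_sq_sub w).const_mul _))).congr_deriv ?_
    simp only [Pi.sub_apply]
    ring
  have hconst := is_const_of_deriv_eq_zero (fun w => (hd w).differentiableAt)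
    (fun w => (hd w).deriv) z 0
  have hK0 : K 0 = (Real.sqrt Real.pi : ℂ) / 2 := by
    have h := integral_gaussian_Ioi 1
    have h' : K 0 = ((∫ u in Set.Ioi (0:ℝ), Real.exp (-1 * u ^ 2) : ℝ) : ℂ) := by
      rw [← integral_complex_ofReal]
      simp [hK]
    rw [h', h]
    simp
  have hpi : (Real.sqrt Real.pi : ℂ) ≠ 0 := by
    exact_mod_cast (Real.sqrt_pos.2 Real.pi_pos).ne'
  have hzero : Lam 0 - 2 / (Real.sqrt Real.pi : ℂ) * K 0 = 0 := by
    rw [hK0, Lam_zero]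
    field_simp
    simp
  simp only [hzero, mul_zero, mul_eq_zero, Complex.exp_ne_zero, false_or] at hconst
  exact sub_eq_zero.1 hconst

lemma norm_Lam_le {z : ℂ} (hz : 0 < z.re) :
    ‖Lam z‖ ≤ 2 / Real.sqrt Real.pi * (2 * z.re)⁻¹ := by
  have hneg : -(2 * z.re) < 0 := by linarith
  rw [Lam_eq_integral, norm_mul, norm_div, Complex.norm_real,
    Real.norm_of_nonneg (Real.sqrt_nonneg _), Complex.norm_ofNat]
  refine mul_le_mul_of_nonneg_left ?_ (by positivity)
  calc ‖∫ u in Set.Ioi (0:ℝ), Complex.exp (-(u : ℂ) ^ 2 - 2 * z * u)‖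
      ≤ ∫ u in Set.Ioi (0:ℝ), Real.exp (-(2 * z.re) * u) := by
        refine norm_integral_le_of_norm_le (integrableOn_exp_mul_Ioi hneg 0)
          (.of_forall fun u => ?_)
        rw [norm_cexp_neg_sq_sub]
        exact Real.exp_le_exp.2 (by nlinarith [sq_nonneg u])
    _ = (2 * z.re)⁻¹ := by
        rw [integral_exp_mul_Ioi hneg]
        simp [neg_div_neg_eq]

lemma tendsto_Lam_of_re_tendsto_atTop {ι : Type*} {l : Filter ι} {w : ι → ℂ}
    (hw : Tendsto (fun i => (w i).re) l atTop) : Tendsto (fun i => Lam (w i)) l (𝓝 0) := by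
  refine squeeze_zero_norm' ((hw.eventually_gt_atTop 0).mono fun i hi => norm_Lam_le hi) ?_
  simpa using (hw.const_mul_atTop zero_lt_two).inv_tendsto_atTop.const_mul
    (2 / Real.sqrt Real.pi)

lemma sqrtit_sq {t : ℝ} (ht : 0 ≤ t) : sqrtit t ^ 2 = Complex.I * t := by
  have h1 : ((Real.sqrt t : ℝ) : ℂ) ^ 2 = t := by exact_mod_cast Real.sq_sqrt ht
  have h2 : ((Real.sqrt 2 : ℝ) : ℂ) ^ 2 = 2 := by
    exact_mod_cast Real.sq_sqrt (zero_le_two (α := ℝ))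
  rw [sqrtit, div_pow, mul_pow, h1, h2]
  linear_combination (t / 2 : ℂ) * Complex.I_sq

lemma sqrtit_ne_zero {t : ℝ} (ht : 0 < t) : sqrtit t ≠ 0 := by
  intro h
  have := sqrtit_sq ht.le
  simp [h, ht.ne'] at this

lemma hasDerivAt_sqrtit {t : ℝ} (ht : 0 < t) :
    HasDerivAt sqrtit (Complex.I / (2 * sqrtit t)) t := by
  have h1 := (((Real.hasDerivAt_sqrt ht.ne').ofReal_comp).mul_const (1 + Complex.I)).div_const
    (Real.sqrt 2 : ℂ)
  refine h1.congr_deriv ?_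
  have hs := sqrtit_ne_zero ht
  have hsq := sqrtit_sq ht.le
  have hr : ((Real.sqrt t : ℝ) : ℂ) ≠ 0 := by exact_mod_cast (Real.sqrt_pos.2 ht).ne'
  have hr2 : ((Real.sqrt t : ℝ) : ℂ) ^ 2 = t := by exact_mod_cast Real.sq_sqrt ht.le
  have h2 : ((Real.sqrt 2 : ℝ) : ℂ) ≠ 0 := by simp
  have hdef : sqrtit t * (Real.sqrt 2 : ℂ) = (Real.sqrt t : ℂ) * (1 + Complex.I) := by
    rw [sqrtit]
    field_simp
  rw [← hr2] at hsq
  push_cast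
  field_simp
  refine mul_left_cancel₀ hr ?_
  linear_combination (-sqrtit t) * hdef + (Real.sqrt 2 : ℂ) * hsq

lemma re_div_sqrtit_add_mul_sqrtit {t : ℝ} (ht : 0 < t) (x : ℝ) (c : ℂ) :
    ((x : ℂ) / (2 * sqrtit t) + c * sqrtit t).re =
      x * Real.sqrt 2 / 4 * (Real.sqrt t)⁻¹ + Real.sqrt t * ((c.re - c.im) / Real.sqrt 2) := by
  have hr : ((Real.sqrt t : ℝ) : ℂ) ≠ 0 := by exact_mod_cast (Real.sqrt_pos.2 ht).ne'
  have h2 : ((Real.sqrt 2 : ℝ) : ℂ) ≠ 0 := by simp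
  have h1 : (1 + Complex.I) ≠ 0 := by
    intro h
    simpa using congrArg Complex.re h
  have hx : (x : ℂ) / (2 * sqrtit t) =
      ((x * Real.sqrt 2 / 4 * (Real.sqrt t)⁻¹ : ℝ) : ℂ) * (1 - Complex.I) := by
    rw [sqrtit]
    push_cast
    field_simp
    linear_combination (2 * x : ℂ) * Complex.I_sq
  have hc : c * sqrtit t = ((Real.sqrt t / Real.sqrt 2 : ℝ) : ℂ) * (c * (1 + Complex.I)) := by
    rw [sqrtit]
    push_cast
    ring
  rw [hx, hc, Complex.add_re, Complex.re_ofReal_mul, Complex.re_ofReal_mul]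
  simp
  ring

/-- The building block `exp(−x²/(4it))·Λ(x/(2√(it)) + c·√(it))`, a solution of the free
Schrödinger equation on `(0,∞) × ℝ`. -/
noncomputable def erfcWave (c : ℂ) (t x : ℝ) : ℂ :=
  Complex.exp (-(x : ℂ) ^ 2 / (4 * Complex.I * t)) * Lam ((x : ℂ) / (2 * sqrtit t) + c * sqrtit t)

/-- A multiple of the free Schrödinger kernel, `exp(−x²/(4it))/(√π·√(it))`. -/
noncomputable def freeKernel (t x : ℝ) : ℂ :=
  Complex.exp (-(x : ℂ) ^ 2 / (4 * Complex.I * t)) / ((Real.sqrt Real.pi : ℂ) * sqrtit t)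

lemma erfcWave_zero_right (c : ℂ) (t : ℝ) : erfcWave c t 0 = Lam (c * sqrtit t) := by
  simp [erfcWave]

lemma hasDerivAt_cexp_neg_sq_div (t x : ℝ) :
    HasDerivAt (fun y : ℝ => Complex.exp (-(y : ℂ) ^ 2 / (4 * Complex.I * t)))
      (Complex.exp (-(x : ℂ) ^ 2 / (4 * Complex.I * t)) * (-(2 * x) / (4 * Complex.I * t))) x := by
  have h := (((hasDerivAt_pow 2 (x : ℂ)).neg).div_const (4 * Complex.I * t)).cexp
  simpa using h.comp_ofReal

lemma hasDerivAt_erfcWave (c : ℂ) {t : ℝ} (ht : 0 < t) (x : ℝ) :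
    HasDerivAt (erfcWave c t) (c * erfcWave c t x - freeKernel t x) x := by
  have hs := sqrtit_ne_zero ht
  have hw : HasDerivAt (fun y : ℝ => (y : ℂ) / (2 * sqrtit t) + c * sqrtit t)
      (1 / (2 * sqrtit t)) x :=
    ((Complex.ofRealCLM.hasDerivAt (x := x)).div_const _).add_const _
  refine ((hasDerivAt_cexp_neg_sq_div t x).mul ((hasDerivAt_Lam _).comp x hw)).congr_deriv ?_
  have hpi : (Real.sqrt Real.pi : ℂ) ≠ 0 := by
    exact_mod_cast (Real.sqrt_pos.2 Real.pi_pos).ne'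
  rw [mul_assoc 4 Complex.I, ← sqrtit_sq ht.le]
  simp only [erfcWave, freeKernel, Function.comp_apply]
  rw [mul_assoc 4 Complex.I, ← sqrtit_sq ht.le]
  field_simp
  ring

lemma hasDerivAt_freeKernel {t : ℝ} (x : ℝ) :
    HasDerivAt (freeKernel t) (-(x / (2 * Complex.I * t)) * freeKernel t x) x := by
  refine ((hasDerivAt_cexp_neg_sq_div t x).div_const _).congr_deriv ?_
  rw [freeKernel]
  ring

lemma hasDerivAt_erfcWave_time (c : ℂ) {t : ℝ} (ht : 0 < t) (x : ℝ) :
    HasDerivAt (fun τ => erfcWave c τ x)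
      (Complex.I * (c * (c * erfcWave c t x - freeKernel t x) +
        x / (2 * Complex.I * t) * freeKernel t x)) t := by
  have hs := sqrtit_ne_zero ht
  have ht' : (t : ℂ) ≠ 0 := by exact_mod_cast ht.ne'
  have hpi : (Real.sqrt Real.pi : ℂ) ≠ 0 := by
    exact_mod_cast (Real.sqrt_pos.2 Real.pi_pos).ne'
  have hs' := hasDerivAt_sqrtit ht
  have he : HasDerivAt (fun τ : ℝ => Complex.exp (-(x : ℂ) ^ 2 / (4 * Complex.I * τ)))
      (Complex.exp (-(x : ℂ) ^ 2 / (4 * Complex.I * t)) *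
        ((x : ℂ) ^ 2 / (4 * Complex.I * t ^ 2))) t := by
    have h1 : HasDerivAt (fun τ : ℝ => 4 * Complex.I * (τ : ℂ)) (4 * Complex.I * 1) t :=
      (Complex.ofRealCLM.hasDerivAt (x := t)).const_mul _
    refine ((hasDerivAt_const t (-(x : ℂ) ^ 2)).div h1 (by simp [ht.ne'])).cexp.congr_deriv ?_
    simp only [Pi.div_apply]
    field_simp
    ring
  have hw := ((hasDerivAt_const t (x : ℂ)).div (hs'.const_mul 2)
    (mul_ne_zero two_ne_zero hs)).add (hs'.const_mul c)
  refine (he.mul ((hasDerivAt_Lam _).comp t hw)).congr_deriv ?_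
  have htI : (t : ℂ) = -Complex.I * sqrtit t ^ 2 := by
    rw [sqrtit_sq ht.le]
    linear_combination (t : ℂ) * Complex.I_sq
  simp only [erfcWave, freeKernel, Function.comp_apply, Pi.add_apply, Pi.div_apply]
  set e := Complex.exp (-(x : ℂ) ^ 2 / (4 * Complex.I * t))
  set L := Lam ((x : ℂ) / (2 * sqrtit t) + c * sqrtit t)
  rw [htI]
  field_simp
  ring_nf
  simp only [Complex.I_pow_four, Complex.I_sq]
  ring

lemma tendsto_erfcWave_zero (c : ℂ) {x : ℝ} (hx : 0 < x) :
    Tendsto (fun t => erfcWave c t x) (𝓝[>] 0) (𝓝 0) := by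
  have hsqrt : Tendsto Real.sqrt (𝓝[>] 0) (𝓝[>] 0) := by
    refine tendsto_nhdsWithin_iff.2 ⟨?_, ?_⟩
    · simpa using (Real.continuous_sqrt.tendsto 0).mono_left nhdsWithin_le_nhds
    · filter_upwards [self_mem_nhdsWithin] with t ht using Real.sqrt_pos.2 ht
  have hre : Tendsto (fun t => ((x : ℂ) / (2 * sqrtit t) + c * sqrtit t).re) (𝓝[>] 0) atTop := by
    have h1 := (tendsto_inv_nhdsGT_zero.comp hsqrt).const_mul_atTop
      (show 0 < x * Real.sqrt 2 / 4 by positivity)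
    have h2 := (hsqrt.mono_right nhdsWithin_le_nhds).mul_const ((c.re - c.im) / Real.sqrt 2)
    refine (h1.atTop_add h2).congr' ?_
    filter_upwards [self_mem_nhdsWithin] with t ht
    rw [re_div_sqrtit_add_mul_sqrtit ht]
    rfl
  refine squeeze_zero_norm (fun t => ?_) (by simpa using (tendsto_Lam_of_re_tendsto_atTop hre).norm)
  have hphase : -(x : ℂ) ^ 2 / (4 * Complex.I * t) = ((x ^ 2 / (4 * t) : ℝ) : ℂ) * Complex.I := by
    push_cast
    rw [mul_assoc, mul_left_comm, ← div_div, div_right_comm, Complex.div_I]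
    ring
  rw [erfcWave, norm_mul, hphase, Complex.norm_exp_ofReal_mul_I, one_mul]

/-- The linear combination of building blocks for which
`Ψ_δ'(t,x;k) = Ψ_free(t,x;k) + sgn(x)·halfLineWave β k t |x|`. -/
noncomputable def halfLineWave (β k t x : ℝ) : ℂ :=
  (β / (2 * ((β : ℂ) + Complex.I * k)) - β / (2 * ((β : ℂ) - Complex.I * k))) * erfcWave β t x +
    Complex.I * k / (2 * ((β : ℂ) + Complex.I * k)) * erfcWave (-(Complex.I * k)) t x +
    Complex.I * k / (2 * ((β : ℂ) - Complex.I * k)) * erfcWave (Complex.I * k) t x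

/-- The derivative of `halfLineWave` in the space variable. -/
noncomputable def halfLineWaveDeriv (β k t x : ℝ) : ℂ :=
  (β / (2 * ((β : ℂ) + Complex.I * k)) - β / (2 * ((β : ℂ) - Complex.I * k))) *
      (β * erfcWave β t x - freeKernel t x) +
    Complex.I * k / (2 * ((β : ℂ) + Complex.I * k)) *
      (-(Complex.I * k) * erfcWave (-(Complex.I * k)) t x - freeKernel t x) +
    Complex.I * k / (2 * ((β : ℂ) - Complex.I * k)) *
      (Complex.I * k * erfcWave (Complex.I * k) t x - freeKernel t x)

lemma hasDerivAt_halfLineWave (β k : ℝ) {t : ℝ} (ht : 0 < t) (x : ℝ) :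
    HasDerivAt (halfLineWave β k t) (halfLineWaveDeriv β k t x) x :=
  (((hasDerivAt_erfcWave _ ht x).const_mul _).add
    ((hasDerivAt_erfcWave _ ht x).const_mul _)).add ((hasDerivAt_erfcWave _ ht x).const_mul _)

lemma exists_hasDerivAt_halfLineWaveDeriv (β k : ℝ) {t : ℝ} (ht : 0 < t) (x : ℝ) :
    ∃ d : ℂ, HasDerivAt (halfLineWaveDeriv β k t) d x ∧
      HasDerivAt (fun τ => halfLineWave β k τ x) (Complex.I * d) t := by
  have h (c : ℂ) : HasDerivAt (fun y => c * erfcWave c t y - freeKernel t y)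
      (c * (c * erfcWave c t x - freeKernel t x) +
        x / (2 * Complex.I * t) * freeKernel t x) x :=
    (((hasDerivAt_erfcWave c ht x).const_mul c).sub (hasDerivAt_freeKernel x)).congr_deriv
      (by ring)
  refine ⟨_, (((h _).const_mul _).add ((h _).const_mul _)).add ((h _).const_mul _), ?_⟩
  refine ((((hasDerivAt_erfcWave_time _ ht x).const_mul _).add
    ((hasDerivAt_erfcWave_time _ ht x).const_mul _)).add
    ((hasDerivAt_erfcWave_time _ ht x).const_mul _)).congr_deriv ?_
  ring

lemma tendsto_halfLineWave_zero (β k : ℝ) {x : ℝ} (hx : 0 < x) :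
    Tendsto (fun t => halfLineWave β k t x) (𝓝[>] 0) (𝓝 0) := by
  have h (a c : ℂ) := (tendsto_erfcWave_zero c hx).const_mul a
  simpa [halfLineWave] using ((h _ _).add (h _ _)).add (h _ _)

lemma halfLine_jump {β : ℝ} (hβ : β ≠ 0) (k : ℝ) {t : ℝ} (ht : 0 < t) :
    β * halfLineWave β k t 0 =
      halfLineWaveDeriv β k t 0 + Complex.I * k * Complex.exp (-(Complex.I * k ^ 2 * t)) := by
  have hp : (β : ℂ) + Complex.I * k ≠ 0 := fun h => hβ (by simpa using congrArg Complex.re h)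
  have hm : (β : ℂ) - Complex.I * k ≠ 0 := fun h => hβ (by simpa using congrArg Complex.re h)
  have hL := Lam_add_Lam_neg (Complex.I * k * sqrtit t)
  have he : (Complex.I * k * sqrtit t) ^ 2 = -(Complex.I * k ^ 2 * t) := by
    rw [mul_pow, mul_pow, sqrtit_sq ht.le, Complex.I_sq]
    ring
  rw [he] at hL
  simp only [halfLineWave, halfLineWaveDeriv, erfcWave_zero_right, neg_mul]
  have hexp : Complex.exp (-(Complex.I * k ^ 2 * t)) =
      (Lam (Complex.I * k * sqrtit t) + Lam (-(Complex.I * k * sqrtit t))) / 2 := by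
    rw [hL]; ring
  rw [hexp]
  field_simp
  ring

/-- The smooth extension to the whole line of the restriction of `Ψ_δ'` to the half-line of
points with sign `σ`. -/
noncomputable def psiHalfLine (σ β k t x : ℝ) : ℂ :=
  psiFree k t x + σ * halfLineWave β k t (σ * x)

/-- The derivative of `psiHalfLine` in the space variable when `σ = ±1`. -/
noncomputable def psiHalfLineDeriv (σ β k t x : ℝ) : ℂ :=
  Complex.I * k * psiFree k t x + halfLineWaveDeriv β k t (σ * x)

lemma hasDerivAt_psiFree (k t x : ℝ) :
    HasDerivAt (psiFree k t) (Complex.I * k * psiFree k t x) x := by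
  have h := (((Complex.ofRealCLM.hasDerivAt (x := x)).const_mul (Complex.I * k)).sub_const
    (Complex.I * k ^ 2 * t)).cexp
  refine h.congr_deriv ?_
  simp only [psiFree, Complex.ofRealCLM_apply, Complex.ofReal_one]
  ring

lemma hasDerivAt_psiFree_time (k t x : ℝ) :
    HasDerivAt (fun τ => psiFree k τ x) (-(Complex.I * k ^ 2) * psiFree k t x) t := by
  have h := (((Complex.ofRealCLM.hasDerivAt (x := t)).const_mul (Complex.I * k ^ 2)).const_sub
    (Complex.I * k * x)).cexp
  refine h.congr_deriv ?_
  simp only [psiFree, Complex.ofRealCLM_apply, Complex.ofReal_one]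
  ring

lemma hasDerivAt_comp_const_mul {f : ℝ → ℂ} {d : ℂ} {σ x : ℝ} (h : HasDerivAt f d (σ * x)) :
    HasDerivAt (fun y => f (σ * y)) (σ * d) x := by
  have := h.scomp x ((hasDerivAt_id x).const_mul σ)
  simpa [Function.comp_def] using this

lemma hasDerivAt_psiHalfLine {σ : ℝ} (hσ : σ ^ 2 = 1) (β k : ℝ) {t : ℝ} (ht : 0 < t) (x : ℝ) :
    HasDerivAt (psiHalfLine σ β k t) (psiHalfLineDeriv σ β k t x) x := by
  have hσ' : (σ : ℂ) ^ 2 = 1 := by exact_mod_cast hσ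
  refine ((hasDerivAt_psiFree k t x).add ((hasDerivAt_comp_const_mul
    (hasDerivAt_halfLineWave β k ht (σ * x))).const_mul (σ : ℂ))).congr_deriv ?_
  rw [psiHalfLineDeriv]
  linear_combination halfLineWaveDeriv β k t (σ * x) * hσ'

lemma exists_hasDerivAt_psiHalfLineDeriv (σ β k : ℝ) {t : ℝ} (ht : 0 < t) (x : ℝ) :
    ∃ d : ℂ, HasDerivAt (psiHalfLineDeriv σ β k t) d x ∧
      HasDerivAt (fun τ => psiHalfLine σ β k τ x) (Complex.I * d) t := by
  obtain ⟨d, hd, hd'⟩ := exists_hasDerivAt_halfLineWaveDeriv β k ht (σ * x)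
  refine ⟨_, ((hasDerivAt_psiFree k t x).const_mul (Complex.I * k)).add
    (hasDerivAt_comp_const_mul hd), ?_⟩
  refine ((hasDerivAt_psiFree_time k t x).add (hd'.const_mul (σ : ℂ))).congr_deriv ?_
  linear_combination (-Complex.I * k ^ 2 * psiFree k t x) * Complex.I_sq

lemma psiDelta'_eq_psiHalfLine {σ x : ℝ} (hσ : σ ^ 2 = 1) (hx : 0 < σ * x) (β k t : ℝ) :
    psiDelta' β k t x = psiHalfLine σ β k t x := by
  obtain ⟨hsign, habs⟩ : Real.sign x = σ ∧ |x| = σ * x := by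
    rcases mul_self_eq_one_iff.1 ((sq σ).symm.trans hσ) with rfl | rfl
    · have hx' : 0 < x := by linarith
      simp [Real.sign_of_pos hx', abs_of_pos hx']
    · have hx' : x < 0 := by linarith
      simp [Real.sign_of_neg hx', abs_of_neg hx']
  have hsq : ((σ * x : ℝ) : ℂ) ^ 2 = (x : ℂ) ^ 2 := by
    rw [← habs]
    exact_mod_cast sq_abs x
  simp only [psiDelta', psiHalfLine, phiDelta', halfLineWave, erfcWave, abs_neg, habs,
    Real.sign_neg, hsign, hsq]
  push_cast
  simp only [neg_sq, mul_neg, neg_mul, sub_neg_eq_add, ← sub_eq_add_neg]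
  ring

lemma psiDelta'_eventuallyEq_psiHalfLine {σ x : ℝ} (hσ : σ ^ 2 = 1) (hx : 0 < σ * x)
    (β k t : ℝ) : psiDelta' β k t =ᶠ[𝓝 x] psiHalfLine σ β k t := by
  have hopen : IsOpen {y : ℝ | 0 < σ * y} := isOpen_lt continuous_const (by fun_prop)
  filter_upwards [hopen.mem_nhds hx] with y hy using psiDelta'_eq_psiHalfLine hσ hy β k t

lemma deriv_psiDelta' {σ x : ℝ} (hσ : σ ^ 2 = 1) (hx : 0 < σ * x) (β k : ℝ) {t : ℝ}
    (ht : 0 < t) : deriv (psiDelta' β k t) x = psiHalfLineDeriv σ β k t x := by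
  rw [(psiDelta'_eventuallyEq_psiHalfLine hσ hx β k t).deriv_eq]
  exact (hasDerivAt_psiHalfLine hσ β k ht x).deriv

lemma psiDelta'_schroedinger {σ x : ℝ} (hσ : σ ^ 2 = 1) (hx : 0 < σ * x) (β k : ℝ) {t : ℝ}
    (ht : 0 < t) :
    Complex.I * deriv (fun τ => psiDelta' β k τ x) t = -iteratedDeriv 2 (psiDelta' β k t) x := by
  obtain ⟨d, hd, hd'⟩ := exists_hasDerivAt_psiHalfLineDeriv σ β k ht x
  have hopen : IsOpen {y : ℝ | 0 < σ * y} := isOpen_lt continuous_const (by fun_prop)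
  have hderiv : deriv (psiDelta' β k t) =ᶠ[𝓝 x] psiHalfLineDeriv σ β k t := by
    filter_upwards [hopen.mem_nhds hx] with y hy using deriv_psiDelta' hσ hy β k ht
  rw [iteratedDeriv_succ, iteratedDeriv_one, hderiv.deriv_eq, hd.deriv]
  simp only [psiDelta'_eq_psiHalfLine hσ hx]
  rw [hd'.deriv, ← mul_assoc, Complex.I_mul_I, neg_one_mul]

lemma tendsto_psiDelta'_of_side {σ : ℝ} (hσ : σ ^ 2 = 1) (β k : ℝ) {t : ℝ} (ht : 0 < t)
    {l : Filter ℝ} (hl : l ≤ 𝓝 0) (hside : ∀ᶠ x in l, 0 < σ * x) :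
    Tendsto (psiDelta' β k t) l (𝓝 (psiHalfLine σ β k t 0)) := by
  refine (((hasDerivAt_psiHalfLine hσ β k ht 0).continuousAt).mono_left hl).congr' ?_
  filter_upwards [hside] with x hx using (psiDelta'_eq_psiHalfLine hσ hx β k t).symm

lemma tendsto_deriv_psiDelta'_of_side {σ : ℝ} (hσ : σ ^ 2 = 1) (β k : ℝ) {t : ℝ} (ht : 0 < t)
    {l : Filter ℝ} (hl : l ≤ 𝓝 0) (hside : ∀ᶠ x in l, 0 < σ * x) :
    Tendsto (deriv (psiDelta' β k t)) l
      (𝓝 (Complex.I * k * psiFree k t 0 + halfLineWaveDeriv β k t 0)) := by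
  obtain ⟨d, hd, -⟩ := exists_hasDerivAt_psiHalfLineDeriv σ β k ht 0
  have h : Tendsto (psiHalfLineDeriv σ β k t) (𝓝 0) _ := hd.continuousAt
  simp only [psiHalfLineDeriv, mul_zero] at h
  refine (h.mono_left hl).congr' ?_
  filter_upwards [hside] with x hx using (deriv_psiDelta' hσ hx β k ht).symm

lemma tendsto_psiDelta'_initial {σ x : ℝ} (hσ : σ ^ 2 = 1) (hx : 0 < σ * x) (β k : ℝ) :
    Tendsto (fun t => psiDelta' β k t x) (𝓝[>] 0) (𝓝 (Complex.exp (Complex.I * k * x))) := by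
  have hfree : Tendsto (fun t => psiFree k t x) (𝓝[>] 0)
      (𝓝 (Complex.exp (Complex.I * k * x))) := by
    have h : Tendsto (fun t => psiFree k t x) (𝓝 0) _ :=
      (hasDerivAt_psiFree_time k 0 x).continuousAt
    simpa [psiFree] using h.mono_left nhdsWithin_le_nhds
  simp only [psiDelta'_eq_psiHalfLine hσ hx, psiHalfLine]
  simpa using hfree.add ((tendsto_halfLineWave_zero β k hx).const_mul (σ : ℂ))

lemma exists_sq_eq_one_and_mul_pos {x : ℝ} (hx : x ≠ 0) : ∃ σ : ℝ, σ ^ 2 = 1 ∧ 0 < σ * x := by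
  rcases hx.lt_or_gt with h | h
  · exact ⟨-1, by norm_num, by linarith⟩
  · exact ⟨1, by norm_num, by linarith⟩

/-- `Ψ_δ'` solves the Schrödinger equation with a δ'-potential of strength `2/β`:
(a) the free equation away from `x = 0`; (b) continuity of `∂ₓΨ` at `x = 0`;
(c) the jump condition `Ψ(t,0⁺) − Ψ(t,0⁻) = (2/β)·∂ₓΨ(t,0)`;
(d) the initial condition `Ψ(0⁺,x) = exp(ikx)`. -/
theorem psiDelta'_solves_deltaprime_schroedinger (β k : ℝ) (hβ : β ≠ 0) :
    (∀ t : ℝ, 0 < t → ∀ x : ℝ, x ≠ 0 →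
      Complex.I * deriv (fun τ : ℝ => psiDelta' β k τ x) t =
        - iteratedDeriv 2 (fun y : ℝ => psiDelta' β k t y) x) ∧
    (∀ t : ℝ, 0 < t → ∃ D Lp Lm : ℂ,
      Tendsto (fun x : ℝ => deriv (fun y : ℝ => psiDelta' β k t y) x)
        (nhdsWithin 0 (Set.Ioi 0)) (nhds D) ∧
      Tendsto (fun x : ℝ => deriv (fun y : ℝ => psiDelta' β k t y) x)
        (nhdsWithin 0 (Set.Iio 0)) (nhds D) ∧
      Tendsto (fun x : ℝ => psiDelta' β k t x) (nhdsWithin 0 (Set.Ioi 0)) (nhds Lp) ∧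
      Tendsto (fun x : ℝ => psiDelta' β k t x) (nhdsWithin 0 (Set.Iio 0)) (nhds Lm) ∧
      Lp - Lm = (2 / (β : ℂ)) * D) ∧
    (∀ x : ℝ, x ≠ 0 →
      Tendsto (fun t : ℝ => psiDelta' β k t x) (nhdsWithin 0 (Set.Ioi 0))
        (nhds (Complex.exp (Complex.I * k * x)))) := by
  refine ⟨fun t ht x hx => ?_, fun t ht => ?_, fun x hx => ?_⟩
  · obtain ⟨σ, hσ, hσx⟩ := exists_sq_eq_one_and_mul_pos hx
    exact psiDelta'_schroedinger hσ hσx β k ht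
  · have hpos : ∀ᶠ x : ℝ in 𝓝[>] 0, 0 < 1 * x := by
      filter_upwards [self_mem_nhdsWithin] with x hx using by simpa using hx
    have hneg : ∀ᶠ x : ℝ in 𝓝[<] 0, 0 < -1 * x := by
      filter_upwards [self_mem_nhdsWithin] with x hx using by simpa using hx
    refine ⟨_, _, _,
      tendsto_deriv_psiDelta'_of_side (one_pow 2) β k ht nhdsWithin_le_nhds hpos,
      tendsto_deriv_psiDelta'_of_side neg_one_sq β k ht nhdsWithin_le_nhds hneg,
      tendsto_psiDelta'_of_side (one_pow 2) β k ht nhdsWithin_le_nhds hpos,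
      tendsto_psiDelta'_of_side neg_one_sq β k ht nhdsWithin_le_nhds hneg, ?_⟩
    have hβ' : (β : ℂ) ≠ 0 := by exact_mod_cast hβ
    have hjump := halfLine_jump hβ k ht
    simp only [psiHalfLine, psiFree, mul_zero, Complex.ofReal_zero, Complex.ofReal_one,
      Complex.ofReal_neg, zero_sub]
    field_simp
    linear_combination 2 * hjump
  · obtain ⟨σ, hσ, hσx⟩ := exists_sq_eq_one_and_mul_pos hx
    exact tendsto_psiDelta'_initial hσ hσx β k
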